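/- Let (u_k, μ_k) be a sequence of pairs in 𝒟 that converges to (u, μ) in 𝒟, and suppose there is an R > 0 such that E(u_k, μ_k) ≤ R for all k. Then ∫_ℝ e^{−x}u_k(x)² dx + ∫_ℝ e^{−x} dμ_k(x) → ∫_ℝ e^{−x}u(x)² dx + ∫_ℝ e^{−x} dμ(x). -/

import Mathlib

open MeasureTheory Filter Set

noncomputable section

/-- An element of the phase space `𝒟`: a pair `(u, μ)` where `u ∈ H¹_loc(ℝ)` (recorded
together with a derivative `u'`), `μ` is a positive Borel measure dominating
`(u² + u'²) dx` and `υ` is the excess measure, subject to the growth restrictions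
at `-∞` and `+∞`. -/
structure PhaseD where
  u : ℝ → ℝ
  u' : ℝ → ℝ
  μ : Measure ℝ
  υ : Measure ℝ
  meas_u' : Measurable u'
  ftc : ∀ a b : ℝ, u b - u a = ∫ x in a..b, u' x
  locInt : LocallyIntegrable u' volume
  locSq : LocallyIntegrable (fun x => (u' x) ^ 2) volume
  decomp : μ = υ + volume.withDensity (fun x => ENNReal.ofReal ((u x) ^ 2 + (u' x) ^ 2))
  minusCond :
    (∫⁻ s in Iio (0 : ℝ), ENNReal.ofReal (Real.exp (-s) * ((u s) ^ 2 + (u' s) ^ 2))) +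
      (∫⁻ s in Iio (0 : ℝ), ENNReal.ofReal (Real.exp (-s)) ∂υ) < ⊤
  plusCond :
    Filter.limsup (fun x : ℝ =>
      ENNReal.ofReal (Real.exp x) *
        ((∫⁻ s in Ioi x, ENNReal.ofReal (Real.exp (-s) * (u s + u' s) ^ 2)) +
          ∫⁻ s in Ici x, ENNReal.ofReal (Real.exp (-s)) ∂υ)) Filter.atTop < ⊤

/-- The function `w̃(x) = -(u(log x) + u'(log x))/x`. -/
def tildeW (D : PhaseD) : ℝ → ℝ := fun x => -(D.u (Real.log x) + D.u' (Real.log x)) / x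

/-- The measure `υ̃`, i.e. the pushforward under `exp` of `e^{-s} dυ(s)`, so that
`υ̃(B) = ∫_{log B} e^{-s} dυ(s)` for Borel `B ⊆ (0,∞)` and `υ̃({0}) = 0`. -/
def tildeV (D : PhaseD) : Measure ℝ :=
  (D.υ.withDensity fun s => ENNReal.ofReal (Real.exp (-s))).map Real.exp

/-- Convergence of a sequence of pairs to a pair in `𝒟`. -/
def ConvD (Dk : ℕ → PhaseD) (D : PhaseD) : Prop :=
  (∀ x : ℝ, Tendsto (fun k => (Dk k).u x) atTop (nhds (D.u x))) ∧
    ∀ᵐ x : ℝ ∂volume,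
      Tendsto (fun k => ∫⁻ s in Iio x, ENNReal.ofReal (Real.exp (-s)) ∂(Dk k).μ) atTop
        (nhds (∫⁻ s in Iio x, ENNReal.ofReal (Real.exp (-s)) ∂D.μ))

/-- The functional `E(u,μ)`. -/
def Efun (D : PhaseD) : ENNReal :=
  ⨆ x : ℝ, ENNReal.ofReal (Real.exp (x / 2)) *
    ((∫⁻ s in Ioi x, ENNReal.ofReal (Real.exp (-s) * (D.u s + D.u' s) ^ 2)) +
      ∫⁻ s in Ici x, ENNReal.ofReal (Real.exp (-s)) ∂D.υ) ^ (1 / 2 : ℝ)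

namespace PhaseD

variable (D : PhaseD)

lemma u_eq (a : ℝ) : D.u = fun x => D.u a + ∫ t in a..x, D.u' t := by
  funext x
  rw [← D.ftc a x]
  ring

lemma intervalIntegrable_u' (a b : ℝ) : IntervalIntegrable D.u' volume a b :=
  intervalIntegrable_iff.mpr
    ((D.locInt.integrableOn_isCompact isCompact_uIcc).mono_set uIoc_subset_uIcc)

lemma continuous_u : Continuous D.u := by
  rw [D.u_eq 0]
  exact continuous_const.add (intervalIntegral.continuous_primitive D.intervalIntegrable_u' 0)

lemma absolutelyContinuousOnInterval_u (a b : ℝ) : AbsolutelyContinuousOnInterval D.u a b := by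
  rw [D.u_eq a]
  have hc : LipschitzOnWith 0 (fun _ : ℝ => D.u a) (uIcc a b) :=
    (LipschitzWith.const _).lipschitzOnWith
  exact hc.absolutelyContinuousOnInterval.fun_add
    ((D.intervalIntegrable_u' a b).absolutelyContinuousOnInterval_intervalIntegral left_mem_uIcc)

lemma ae_hasDerivAt_u : ∀ᵐ x, HasDerivAt D.u (D.u' x) x := by
  filter_upwards [LocallyIntegrable.ae_hasDerivAt_integral D.locInt] with x hx
  rw [D.u_eq 0]
  exact (hx 0).const_add _

/-- The weighted square `e^{-x} u(x)²`. -/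
def weightedSq (x : ℝ) : ℝ := Real.exp (-x) * D.u x ^ 2

lemma weightedSq_nonneg (x : ℝ) : 0 ≤ D.weightedSq x := by
  unfold weightedSq; positivity

lemma continuous_weightedSq : Continuous D.weightedSq := by
  have := D.continuous_u
  unfold weightedSq; fun_prop

lemma measurable_ofReal_weightedSq : Measurable fun x => ENNReal.ofReal (D.weightedSq x) :=
  D.continuous_weightedSq.measurable.ennreal_ofReal

lemma absolutelyContinuousOnInterval_exp_neg (a b : ℝ) :
    AbsolutelyContinuousOnInterval (fun x : ℝ => Real.exp (-x)) a b := by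
  have hd : ContDiff ℝ 1 (fun x : ℝ => Real.exp (-x)) := by fun_prop
  obtain ⟨K, hK⟩ := hd.contDiffOn.exists_lipschitzOnWith (s := uIcc a b) one_ne_zero
    (convex_uIcc a b) isCompact_uIcc
  exact hK.absolutelyContinuousOnInterval

lemma intervalIntegrable_energy (a b : ℝ) :
    IntervalIntegrable (fun x => Real.exp (-x) * (D.u x ^ 2 + D.u' x ^ 2)) volume a b := by
  have hu := D.continuous_u
  refine IntervalIntegrable.continuousOn_mul (IntervalIntegrable.add ?_ ?_) (by fun_prop)
  · exact (hu.pow 2).intervalIntegrable a b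
  · exact intervalIntegrable_iff.mpr
      ((D.locSq.integrableOn_isCompact isCompact_uIcc).mono_set uIoc_subset_uIcc)

lemma intervalIntegrable_deriv_weightedSq (a b : ℝ) :
    IntervalIntegrable (fun x => Real.exp (-x) * (2 * D.u x * D.u' x - D.u x ^ 2))
      volume a b := by
  have hu := D.continuous_u
  refine IntervalIntegrable.continuousOn_mul (IntervalIntegrable.sub ?_ ?_) (by fun_prop)
  · exact (D.intervalIntegrable_u' a b).continuousOn_mul (by fun_prop)
  · exact (hu.pow 2).intervalIntegrable a b

lemma integral_deriv_weightedSq (a b : ℝ) :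
    ∫ x in a..b, Real.exp (-x) * (2 * D.u x * D.u' x - D.u x ^ 2) =
      D.weightedSq b - D.weightedSq a := by
  have hu := D.absolutelyContinuousOnInterval_u a b
  have hac : AbsolutelyContinuousOnInterval D.weightedSq a b := by
    have := (absolutelyContinuousOnInterval_exp_neg a b).fun_mul (hu.fun_mul hu)
    convert this using 2
    simp only [weightedSq, sq]
  rw [← hac.integral_deriv_eq_sub]
  refine intervalIntegral.integral_congr_ae ?_
  filter_upwards [D.ae_hasDerivAt_u] with x hx _
  have h := (hasDerivAt_neg x).exp.mul (hx.pow 2)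
  refine (h.deriv.trans ?_).symm
  simp
  ring

lemma weightedSq_le {a b : ℝ} (hab : a ≤ b) :
    ENNReal.ofReal (D.weightedSq b) ≤ ENNReal.ofReal (D.weightedSq a) +
      ∫⁻ s in Ioc a b, ENNReal.ofReal (Real.exp (-s) * (D.u s ^ 2 + D.u' s ^ 2)) := by
  have hint := D.intervalIntegrable_energy a b
  have hle := intervalIntegral.integral_mono_on hab (D.intervalIntegrable_deriv_weightedSq a b)
    hint (fun x _ => mul_le_mul_of_nonneg_left
      (by nlinarith [sq_nonneg (D.u x - D.u' x), sq_nonneg (D.u x)]) (Real.exp_pos (-x)).le)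
  rw [D.integral_deriv_weightedSq, intervalIntegral.integral_of_le hab] at hle
  rw [← ofReal_integral_eq_lintegral_ofReal
      ((intervalIntegrable_iff_integrableOn_Ioc_of_le hab).1 hint)
      (ae_of_all _ fun x => by positivity),
    ← ENNReal.ofReal_add (D.weightedSq_nonneg a) (integral_nonneg fun x => by positivity)]
  exact ENNReal.ofReal_le_ofReal (by linarith)

lemma lintegral_Ioc_energy_le {a b : ℝ} (hab : a ≤ b) :
    ∫⁻ s in Ioc a b, ENNReal.ofReal
        (D.weightedSq s + Real.exp (-s) * (D.u s ^ 2 + D.u' s ^ 2)) ≤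
      ENNReal.ofReal (D.weightedSq a) +
        ∫⁻ s in Ioc a b, ENNReal.ofReal (Real.exp (-s) * (D.u s + D.u' s) ^ 2) := by
  have hint := (D.continuous_weightedSq.intervalIntegrable a b).add
    (D.intervalIntegrable_energy a b)
  have hder := D.intervalIntegrable_deriv_weightedSq a b
  have heq : (fun s => Real.exp (-s) * (D.u s + D.u' s) ^ 2) = fun s =>
      (D.weightedSq s + Real.exp (-s) * (D.u s ^ 2 + D.u' s ^ 2)) +
        Real.exp (-s) * (2 * D.u s * D.u' s - D.u s ^ 2) := by
    funext s; unfold weightedSq; ring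
  have hsum : IntervalIntegrable (fun s => Real.exp (-s) * (D.u s + D.u' s) ^ 2)
      volume a b := by
    rw [heq]; exact hint.add hder
  have hval := intervalIntegral.integral_add hint hder
  rw [← heq, D.integral_deriv_weightedSq] at hval
  rw [← ofReal_integral_eq_lintegral_ofReal
      ((intervalIntegrable_iff_integrableOn_Ioc_of_le hab).1 hint)
      (ae_of_all _ fun x => add_nonneg (D.weightedSq_nonneg x) (by positivity)),
    ← ofReal_integral_eq_lintegral_ofReal
      ((intervalIntegrable_iff_integrableOn_Ioc_of_le hab).1 hsum)
      (ae_of_all _ fun x => by positivity),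
    ← ENNReal.ofReal_add (D.weightedSq_nonneg a) (integral_nonneg fun x => by positivity),
    ← intervalIntegral.integral_of_le hab, ← intervalIntegral.integral_of_le hab, hval]
  refine ENNReal.ofReal_le_ofReal ?_
  have := D.weightedSq_nonneg b
  linarith

lemma lintegral_Ioi_energy_le (a : ℝ) :
    ∫⁻ s in Ioi a, ENNReal.ofReal
        (D.weightedSq s + Real.exp (-s) * (D.u s ^ 2 + D.u' s ^ 2)) ≤
      ENNReal.ofReal (D.weightedSq a) +
        ∫⁻ s in Ioi a, ENNReal.ofReal (Real.exp (-s) * (D.u s + D.u' s) ^ 2) := by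
  have hU : Ioi a = ⋃ n : ℕ, Ioc a (a + n) := by
    ext x
    simp only [mem_Ioi, mem_iUnion, mem_Ioc]
    refine ⟨fun hx => ?_, fun ⟨_, hx, _⟩ => hx⟩
    obtain ⟨n, hn⟩ := exists_nat_ge (x - a)
    exact ⟨n, hx, by linarith⟩
  have hmono : Monotone fun n : ℕ => Ioc a (a + n) := fun m n hmn =>
    Ioc_subset_Ioc_right (by gcongr)
  conv_lhs => rw [hU, setLIntegral_iUnion_of_directed _ hmono.directed_le]
  refine iSup_le fun n => (D.lintegral_Ioc_energy_le (by simp)).trans ?_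
  gcongr
  exact Ioc_subset_Ioi_self

/-- The measure `e^{-x} u(x)² dx`. -/
def sqMeasure : Measure ℝ := volume.withDensity fun x => ENNReal.ofReal (D.weightedSq x)

/-- The measure `e^{-x} dμ(x)`. -/
def weightedMu : Measure ℝ := D.μ.withDensity fun x => ENNReal.ofReal (Real.exp (-x))

lemma measurable_exp_neg : Measurable fun x : ℝ => ENNReal.ofReal (Real.exp (-x)) :=
  (Real.continuous_exp.comp continuous_neg).measurable.ennreal_ofReal

lemma weightedMu_apply {s : Set ℝ} (hs : MeasurableSet s) :
    D.weightedMu s = (∫⁻ x in s, ENNReal.ofReal (Real.exp (-x)) ∂D.υ) +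
      ∫⁻ x in s, ENNReal.ofReal (Real.exp (-x) * (D.u x ^ 2 + D.u' x ^ 2)) := by
  have hm : Measurable fun x => ENNReal.ofReal (D.u x ^ 2 + D.u' x ^ 2) :=
    ((D.continuous_u.measurable.pow_const 2).add (D.meas_u'.pow_const 2)).ennreal_ofReal
  rw [weightedMu, withDensity_apply _ hs, D.decomp, Measure.restrict_add, lintegral_add_measure,
    setLIntegral_withDensity_eq_setLIntegral_mul _ hm measurable_exp_neg hs]
  congr 1
  refine lintegral_congr fun x => ?_
  rw [Pi.mul_apply, mul_comm, ENNReal.ofReal_mul (Real.exp_pos _).le]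

lemma sqMeasure_le_weightedMu {s : Set ℝ} (hs : MeasurableSet s) :
    D.sqMeasure s ≤ D.weightedMu s := by
  rw [D.weightedMu_apply hs, sqMeasure, withDensity_apply _ hs]
  refine le_add_left (lintegral_mono fun x => ENNReal.ofReal_le_ofReal ?_)
  exact mul_le_mul_of_nonneg_left (by nlinarith [sq_nonneg (D.u' x)]) (Real.exp_pos _).le

lemma weightedSq_le_add_weightedMu {a b c : ℝ} (hab : a ≤ b) (hbc : b < c) :
    ENNReal.ofReal (D.weightedSq b) ≤
      ENNReal.ofReal (D.weightedSq a) + D.weightedMu (Iio c) := by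
  refine (D.weightedSq_le hab).trans ?_
  rw [D.weightedMu_apply measurableSet_Iio]
  gcongr
  refine le_add_left (lintegral_mono_set fun x hx => hx.2.trans_lt hbc)

lemma tail_le_of_Efun_le {R : ℝ} (hR : 0 ≤ R) (hE : Efun D ≤ ENNReal.ofReal R) (x : ℝ) :
    D.sqMeasure (Ici x) + D.weightedMu (Ici x) ≤
      ENNReal.ofReal (D.weightedSq x) + ENNReal.ofReal (R ^ 2 * Real.exp (-x)) := by
  have hG : (∫⁻ s in Ioi x, ENNReal.ofReal (Real.exp (-s) * (D.u s + D.u' s) ^ 2)) +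
      ∫⁻ s in Ici x, ENNReal.ofReal (Real.exp (-s)) ∂D.υ ≤
        ENNReal.ofReal (R ^ 2 * Real.exp (-x)) := by
    have h1 := (le_iSup (fun x : ℝ => ENNReal.ofReal (Real.exp (x / 2)) *
      ((∫⁻ s in Ioi x, ENNReal.ofReal (Real.exp (-s) * (D.u s + D.u' s) ^ 2)) +
        ∫⁻ s in Ici x, ENNReal.ofReal (Real.exp (-s)) ∂D.υ) ^ (1 / 2 : ℝ)) x).trans hE
    set G := (∫⁻ s in Ioi x, ENNReal.ofReal (Real.exp (-s) * (D.u s + D.u' s) ^ 2)) +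
      ∫⁻ s in Ici x, ENNReal.ofReal (Real.exp (-s)) ∂D.υ
    have h2 := pow_le_pow_left' h1 2
    have h3 : (G ^ (1 / 2 : ℝ)) ^ 2 = G := by
      rw [← ENNReal.rpow_natCast, ← ENNReal.rpow_mul]; norm_num
    rw [mul_pow, h3, ← ENNReal.ofReal_pow (Real.exp_pos _).le, ← ENNReal.ofReal_pow hR,
      ← Real.exp_nat_mul] at h2
    calc G = ENNReal.ofReal (Real.exp (-x)) *
          (ENNReal.ofReal (Real.exp ((2 : ℕ) * (x / 2))) * G) := by
            rw [← mul_assoc, ← ENNReal.ofReal_mul (Real.exp_pos _).le, ← Real.exp_add]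
            norm_num
            ring_nf
            simp
      _ ≤ ENNReal.ofReal (Real.exp (-x)) * ENNReal.ofReal (R ^ 2) := by gcongr
      _ = ENNReal.ofReal (R ^ 2 * Real.exp (-x)) := by
            rw [← ENNReal.ofReal_mul (Real.exp_pos _).le, mul_comm]
  have hsplit : D.sqMeasure (Ici x) + D.weightedMu (Ici x) =
      (∫⁻ s in Ioi x, ENNReal.ofReal
        (D.weightedSq s + Real.exp (-s) * (D.u s ^ 2 + D.u' s ^ 2))) +
        ∫⁻ s in Ici x, ENNReal.ofReal (Real.exp (-s)) ∂D.υ := by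
    have hae : (Ici x : Set ℝ) =ᵐ[volume] Ioi x := Ioi_ae_eq_Ici.symm
    rw [D.weightedMu_apply measurableSet_Ici, sqMeasure, withDensity_apply _ measurableSet_Ici,
      setLIntegral_congr hae, setLIntegral_congr hae]
    simp_rw [fun s => ENNReal.ofReal_add (D.weightedSq_nonneg s)
      (show 0 ≤ Real.exp (-s) * (D.u s ^ 2 + D.u' s ^ 2) by positivity)]
    rw [lintegral_add_left D.measurable_ofReal_weightedSq]
    ring
  rw [hsplit]
  calc _ ≤ _ := add_le_add_left (D.lintegral_Ioi_energy_le x) _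
    _ ≤ _ := by rw [add_assoc]; gcongr

lemma lintegral_add_lintegral_eq :
    (∫⁻ x, ENNReal.ofReal (Real.exp (-x) * D.u x ^ 2)) +
        ∫⁻ x, ENNReal.ofReal (Real.exp (-x)) ∂D.μ =
      D.sqMeasure univ + D.weightedMu univ := by
  rw [sqMeasure, weightedMu, withDensity_apply _ MeasurableSet.univ,
    withDensity_apply _ MeasurableSet.univ, Measure.restrict_univ, Measure.restrict_univ]
  rfl

lemma exists_weightedSq_le {P : ℝ → Prop} (hP : ∀ᵐ x, P x) (hfin : D.sqMeasure univ ≠ ⊤)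
    {ε : ENNReal} (hε : ε ≠ 0) (a : ℝ) :
    ∃ x, a < x ∧ P x ∧ ENNReal.ofReal (D.weightedSq x) ≤ ε := by
  by_contra! hcon
  refine hfin (top_unique ?_)
  calc (⊤ : ENNReal) = ∫⁻ _ in Ioi a, ε := by simp [hε]
    _ ≤ ∫⁻ x in Ioi a, ENNReal.ofReal (D.weightedSq x) := by
        refine lintegral_mono_ae ?_
        filter_upwards [ae_restrict_of_ae hP, ae_restrict_mem measurableSet_Ioi] with x hx hax
        exact (hcon x hax hx).le
    _ ≤ D.sqMeasure univ := by
        rw [sqMeasure, withDensity_apply _ MeasurableSet.univ]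
        exact lintegral_mono_set (subset_univ _)

lemma exists_weightedMu_Iio_le {ε : ENNReal} (hε : ε ≠ 0) (hfin : D.weightedMu univ ≠ ⊤)
    {P : ℝ → Prop} (hP : ∀ᵐ x, P x) (b : ℝ) :
    ∃ y, y < b ∧ P y ∧ D.weightedMu (Iio y) ≤ ε := by
  have hlim : Tendsto (fun n : ℕ => D.weightedMu (Iio (-(n : ℝ)))) atTop (nhds 0) := by
    have hempty : ⋂ n : ℕ, Iio (-(n : ℝ)) = ∅ := by
      refine eq_empty_of_forall_notMem fun x hx => ?_
      obtain ⟨n, hn⟩ := exists_nat_ge (-x)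
      have := mem_iInter.1 hx n
      rw [mem_Iio] at this
      linarith
    have := tendsto_measure_iInter_atTop (μ := D.weightedMu)
      (s := fun n : ℕ => Iio (-(n : ℝ))) (fun n => measurableSet_Iio.nullMeasurableSet)
      (fun m n hmn => Iio_subset_Iio (by simpa using hmn))
      ⟨0, measure_ne_top_of_subset (subset_univ _) hfin⟩
    rwa [hempty, measure_empty] at this
  obtain ⟨n, hn⟩ := (hlim.eventually (gt_mem_nhds (pos_iff_ne_zero.2 hε))).exists
  obtain ⟨y, hy, hyn⟩ := (Measure.dense_of_ae hP).exists_lt (min b (-(n : ℝ)))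
  exact ⟨y, hyn.trans_le (min_le_left _ _), hy,
    (measure_mono (Iio_subset_Iio (hyn.le.trans (min_le_right _ _)))).trans hn.le⟩

end PhaseD

lemma ENNReal.liminf_add_liminf_le (f g : ℕ → ENNReal) :
    liminf f atTop + liminf g atTop ≤ liminf (fun k => f k + g k) atTop := by
  rw [liminf_eq_iSup_iInf_of_nat (u := f), liminf_eq_iSup_iInf_of_nat (u := g)]
  refine ENNReal.iSup_add_iSup_le fun m n => le_liminf_of_le (by isBoundedDefault) ?_
  filter_upwards [eventually_ge_atTop m, eventually_ge_atTop n] with k hm hn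
  exact add_le_add (iInf₂_le k hm) (iInf₂_le k hn)

lemma ConvD.tendsto_weightedSq {Dk : ℕ → PhaseD} {D : PhaseD} (h : ConvD Dk D) (x : ℝ) :
    Tendsto (fun k => ENNReal.ofReal ((Dk k).weightedSq x)) atTop
      (nhds (ENNReal.ofReal (D.weightedSq x))) :=
  ENNReal.tendsto_ofReal (((h.1 x).pow 2).const_mul _)

lemma ConvD.ae_tendsto_weightedMu {Dk : ℕ → PhaseD} {D : PhaseD} (h : ConvD Dk D) :
    ∀ᵐ x : ℝ, Tendsto (fun k => (Dk k).weightedMu (Iio x)) atTop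
      (nhds (D.weightedMu (Iio x))) := by
  simpa only [PhaseD.weightedMu, withDensity_apply _ measurableSet_Iio] using h.2

lemma ConvD.sqMeasure_le_liminf {Dk : ℕ → PhaseD} {D : PhaseD} (h : ConvD Dk D) :
    D.sqMeasure univ ≤ liminf (fun k => (Dk k).sqMeasure univ) atTop := by
  simp only [PhaseD.sqMeasure, withDensity_apply _ MeasurableSet.univ]
  refine le_trans (lintegral_mono fun x => ?_)
    (lintegral_liminf_le fun k => (Dk k).measurable_ofReal_weightedSq)
  exact (h.tendsto_weightedSq x).liminf_eq.ge

lemma ConvD.weightedMu_le_liminf {Dk : ℕ → PhaseD} {D : PhaseD} (h : ConvD Dk D) :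
    D.weightedMu univ ≤ liminf (fun k => (Dk k).weightedMu univ) atTop := by
  have hU : ⋃ n : ℕ, Iio (n : ℝ) = univ := eq_univ_of_forall fun x =>
    mem_iUnion.2 (exists_nat_gt x)
  have hlim := tendsto_measure_iUnion_atTop (μ := D.weightedMu)
    (s := fun n : ℕ => Iio (n : ℝ)) (fun m n hmn => Iio_subset_Iio (by simpa using hmn))
  rw [hU] at hlim
  refine le_of_tendsto' hlim fun n => ?_
  obtain ⟨x, hx, hnx⟩ := (Measure.dense_of_ae h.ae_tendsto_weightedMu).exists_gt (n : ℝ)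
  calc D.weightedMu (Iio (n : ℝ)) ≤ D.weightedMu (Iio x) :=
        measure_mono (Iio_subset_Iio hnx.le)
    _ = liminf (fun k => (Dk k).weightedMu (Iio x)) atTop := (Tendsto.liminf_eq hx).symm
    _ ≤ _ := liminf_le_liminf (Eventually.of_forall fun k => measure_mono (subset_univ _))

lemma ConvD.tendsto_sqMeasure_Ico {Dk : ℕ → PhaseD} {D : PhaseD} (h : ConvD Dk D) {y x : ℝ}
    (hx : Tendsto (fun k => (Dk k).weightedMu (Iio x)) atTop (nhds (D.weightedMu (Iio x))))
    (hfin : D.weightedMu univ ≠ ⊤) :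
    Tendsto (fun k => (Dk k).sqMeasure (Ico y x)) atTop (nhds (D.sqMeasure (Ico y x))) := by
  simp only [PhaseD.sqMeasure, withDensity_apply _ measurableSet_Ico]
  have hlim := (h.tendsto_weightedSq y).add hx
  have hne : ENNReal.ofReal (D.weightedSq y) + D.weightedMu (Iio x) ≠ ⊤ :=
    ENNReal.add_ne_top.2 ⟨ENNReal.ofReal_ne_top, measure_ne_top_of_subset (subset_univ _) hfin⟩
  obtain ⟨C, hC, hCtop⟩ := exists_between hne.lt_top
  refine tendsto_lintegral_filter_of_dominated_convergence (fun _ => C)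
    (Eventually.of_forall fun k => (Dk k).measurable_ofReal_weightedSq) ?_ ?_
    (ae_of_all _ fun s => h.tendsto_weightedSq s)
  · filter_upwards [hlim.eventually (gt_mem_nhds hC)] with k hk
    filter_upwards [ae_restrict_mem measurableSet_Ico] with s hs
    exact ((Dk k).weightedSq_le_add_weightedMu hs.1 hs.2).trans hk.le
  · simpa using ENNReal.mul_ne_top hCtop.ne ENNReal.ofReal_ne_top

lemma PhaseD.total_le {D : PhaseD} {R : ℝ} (hR : 0 ≤ R) (hE : Efun D ≤ ENNReal.ofReal R)
    {y x : ℝ} (hyx : y ≤ x) :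
    D.sqMeasure univ + D.weightedMu univ ≤
      D.weightedMu (Iio y) + D.sqMeasure (Ico y x) + D.weightedMu (Iio x) +
        (ENNReal.ofReal (D.weightedSq x) + ENNReal.ofReal (R ^ 2 * Real.exp (-x))) := by
  have h1 : D.sqMeasure univ ≤
      D.weightedMu (Iio y) + D.sqMeasure (Ico y x) + D.sqMeasure (Ici x) := by
    rw [← Iio_union_Ici (a := x), ← Iio_union_Ico_eq_Iio hyx]
    refine (measure_union_le _ _).trans (add_le_add_left ((measure_union_le _ _).trans ?_) _)
    exact add_le_add_left (D.sqMeasure_le_weightedMu measurableSet_Iio) _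
  have h2 : D.weightedMu univ ≤ D.weightedMu (Iio x) + D.weightedMu (Ici x) := by
    rw [← Iio_union_Ici (a := x)]
    exact measure_union_le _ _
  calc _ ≤ _ := add_le_add h1 h2
    _ = D.weightedMu (Iio y) + D.sqMeasure (Ico y x) + D.weightedMu (Iio x) +
        (D.sqMeasure (Ici x) + D.weightedMu (Ici x)) := by ring
    _ ≤ _ := add_le_add_right (D.tail_le_of_Efun_le hR hE x) _

lemma ConvD.limsup_le {Dk : ℕ → PhaseD} {D : PhaseD} (h : ConvD Dk D) {R : ℝ} (hR : 0 ≤ R)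
    (hE : ∀ k, Efun (Dk k) ≤ ENNReal.ofReal R) :
    limsup (fun k => (Dk k).sqMeasure univ + (Dk k).weightedMu univ) atTop ≤
      D.sqMeasure univ + D.weightedMu univ := by
  by_cases htop : D.weightedMu univ = ⊤
  · simp [htop]
  have hsq : D.sqMeasure univ ≠ ⊤ :=
    ((D.sqMeasure_le_weightedMu MeasurableSet.univ).trans_lt (lt_top_iff_ne_top.2 htop)).ne
  refine ENNReal.le_of_forall_pos_le_add fun ε hε _ => ?_
  have hδ : (ε / 3 : ENNReal) ≠ 0 := by
    simpa using hε.ne'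
  have hexp : Tendsto (fun x => ENNReal.ofReal (R ^ 2 * Real.exp (-x))) atTop (nhds 0) := by
    simpa using ENNReal.tendsto_ofReal (Real.tendsto_exp_neg_atTop_nhds_zero.const_mul (R ^ 2))
  obtain ⟨a, ha⟩ := eventually_atTop.1 (hexp.eventually (gt_mem_nhds (pos_iff_ne_zero.2 hδ)))
  obtain ⟨x, hax, hx, hxδ⟩ := D.exists_weightedSq_le h.ae_tendsto_weightedMu hsq hδ a
  obtain ⟨y, hyx, hy, hyδ⟩ := D.exists_weightedMu_Iio_le hδ htop h.ae_tendsto_weightedMu x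
  have hlim := ((hy.add (h.tendsto_sqMeasure_Ico (y := y) hx htop)).add hx).add
    ((h.tendsto_weightedSq x).add
      (tendsto_const_nhds (x := ENNReal.ofReal (R ^ 2 * Real.exp (-x)))))
  calc _ ≤ _ := limsup_le_limsup
        (Eventually.of_forall fun k => PhaseD.total_le hR (hE k) hyx.le)
    _ = _ := hlim.limsup_eq
    _ ≤ ε / 3 + D.sqMeasure univ + D.weightedMu univ + (ε / 3 + ε / 3) := by
        gcongr
        · exact subset_univ _
        · exact subset_univ _
        · exact (ha x hax.le).le
    _ = D.sqMeasure univ + D.weightedMu univ + (ε / 3 + ε / 3 + ε / 3) := by ring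
    _ = _ := by rw [ENNReal.add_thirds]

/-- If `(u_k,μ_k) → (u,μ)` in `𝒟` and `E(u_k,μ_k) ≤ R` for all `k`,
then `∫ e^{-x}u_k² dx + ∫ e^{-x} dμ_k → ∫ e^{-x}u² dx + ∫ e^{-x} dμ`. -/
theorem statement17 (Dk : ℕ → PhaseD) (D : PhaseD) (h : ConvD Dk D)
    (R : ℝ) (hR : 0 < R) (hE : ∀ k, Efun (Dk k) ≤ ENNReal.ofReal R) :
    Tendsto (fun k =>
        (∫⁻ x, ENNReal.ofReal (Real.exp (-x) * ((Dk k).u x) ^ 2)) +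
          ∫⁻ x, ENNReal.ofReal (Real.exp (-x)) ∂(Dk k).μ) atTop
      (nhds ((∫⁻ x, ENNReal.ofReal (Real.exp (-x) * (D.u x) ^ 2)) +
        ∫⁻ x, ENNReal.ofReal (Real.exp (-x)) ∂D.μ)) := by
  simp only [PhaseD.lintegral_add_lintegral_eq]
  refine tendsto_of_le_liminf_of_limsup_le ?_ (h.limsup_le hR.le hE)
  exact (add_le_add h.sqMeasure_le_liminf h.weightedMu_le_liminf).trans
    (ENNReal.liminf_add_liminf_le _ _)

end
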